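/- arXiv:2509.23068 — 3 statements merged into one kernel-verified Lean document; each statement's English description precedes it below -/
import Mathlib

section
/- Let E₁, …, E_G be finite-dimensional real inner product spaces, let X_g : E_g → ℝⁿ be linear maps, let y ∈ ℝⁿ, let λ > 0 and w₁, …, w_G > 0, and define the group-lasso objective F(θ) = (1/(2n))‖y − Σ_g X_g θ_g‖² + λ Σ_g w_g ‖θ_g‖ for θ = (θ₁, …, θ_G) in the product space Π_g E_g. If θ̂ is a global minimizer of F, then for every group g the dual feasibility bound ‖(1/n) X_g^*(y − Σ_{g'} X_{g'} θ̂_{g'})‖ ≤ λ w_g holds, where X_g^* denotes the adjoint of X_g. -/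
open scoped BigOperators

/-- **Dual feasibility for the group lasso**: at a global minimizer of the group-lasso
objective, every group satisfies `‖(1/n) X_g^*(y − X θ̂)‖ ≤ λ w_g`. -/
theorem group_lasso_dual_feasibility
    {n G : ℕ} (hn : 0 < n) (E : Fin G → Type*)
    [∀ g, NormedAddCommGroup (E g)] [∀ g, InnerProductSpace ℝ (E g)]
    [∀ g, FiniteDimensional ℝ (E g)]
    (X : ∀ g, E g →L[ℝ] EuclideanSpace ℝ (Fin n))
    (y : EuclideanSpace ℝ (Fin n))
    (lam : ℝ) (hlam : 0 < lam) (w : Fin G → ℝ) (hw : ∀ g, 0 < w g)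
    (F : (∀ g, E g) → ℝ)
    (hF : ∀ θ : ∀ g, E g, F θ =
      (1 / (2 * (n : ℝ))) * ‖y - ∑ g, X g (θ g)‖ ^ 2 + lam * ∑ g, w g * ‖θ g‖)
    (θhat : ∀ g, E g) (hmin : ∀ θ : ∀ g, E g, F θhat ≤ F θ) :
    ∀ g, ‖(1 / (n : ℝ)) •
        (ContinuousLinearMap.adjoint (X g)) (y - ∑ g', X g' (θhat g'))‖ ≤ lam * w g := by
  intro g
  set r := y - ∑ g', X g' (θhat g') with hr
  set v := (ContinuousLinearMap.adjoint (X g)) r with hv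
  have hn' : (0 : ℝ) < n := by exact_mod_cast hn
  have hin : inner ℝ r (X g v) = ‖v‖ ^ 2 := by
    rw [← ContinuousLinearMap.adjoint_inner_left, ← hv, real_inner_self_eq_norm_sq]
  have key : ∀ t : ℝ, 0 < t →
      ‖v‖ ^ 2 ≤ n * (lam * w g) * ‖v‖ + t * (‖X g v‖ ^ 2 / 2) := by
    intro t ht
    have h := hmin (θhat + Pi.single g (t • v))
    rw [hF, hF, ← hr] at h
    have h1 : ∑ g', X g' ((θhat + Pi.single g (t • v)) g')
        = ∑ g', X g' (θhat g') + t • X g v := by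
      simp only [Pi.add_apply, map_add, Finset.sum_add_distrib]
      congr 1
      rw [Finset.sum_eq_single g]
      · simp
      · intro b _ hb
        simp [Pi.single_eq_of_ne hb]
      · simp
    have h2 : ∑ g', w g' * ‖(θhat + Pi.single g (t • v)) g'‖
        ≤ ∑ g', w g' * ‖θhat g'‖ + w g * (t * ‖v‖) := by
      have h3 : ∑ g', w g' * ‖(Pi.single g (t • v) : ∀ g, E g) g'‖ = w g * (t * ‖v‖) := by
        rw [Finset.sum_eq_single g]
        · simp [norm_smul, abs_of_pos ht]
        · intro b _ hb
          simp [Pi.single_eq_of_ne hb]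
        · simp
      rw [← h3, ← Finset.sum_add_distrib]
      refine Finset.sum_le_sum fun i _ => ?_
      rw [← mul_add]
      exact mul_le_mul_of_nonneg_left (norm_add_le _ _) (hw i).le
    have h4 : ‖r - t • X g v‖ ^ 2 = ‖r‖ ^ 2 - 2 * (t * ‖v‖ ^ 2) + t ^ 2 * ‖X g v‖ ^ 2 := by
      rw [norm_sub_sq_real, inner_smul_right, hin, norm_smul, mul_pow, Real.norm_eq_abs, sq_abs]
    rw [h1, ← sub_sub, ← hr, h4] at h
    have h5 := mul_le_mul_of_nonneg_left h2 hlam.le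
    have h6 : 0 ≤ (1 / (2 * (n : ℝ))) * (- 2 * (t * ‖v‖ ^ 2) + t ^ 2 * ‖X g v‖ ^ 2)
        + lam * (w g * (t * ‖v‖)) := by linarith
    have h7 : (1 / (2 * (n : ℝ))) * (- 2 * (t * ‖v‖ ^ 2) + t ^ 2 * ‖X g v‖ ^ 2)
        + lam * (w g * (t * ‖v‖)) = (t / n) *
          (n * (lam * w g) * ‖v‖ + t * (‖X g v‖ ^ 2 / 2) - ‖v‖ ^ 2) := by
      field_simp
      ring
    rw [h7] at h6
    linarith [nonneg_of_mul_nonneg_right h6 (div_pos ht hn')]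
  have hlim : ‖v‖ ^ 2 ≤ n * (lam * w g) * ‖v‖ := by
    refine le_of_forall_pos_le_add fun ε hε => ?_
    have hc : 0 < ‖X g v‖ ^ 2 / 2 + 1 := by positivity
    refine (key (ε / (‖X g v‖ ^ 2 / 2 + 1)) (by positivity)).trans ?_
    gcongr
    rw [div_mul_eq_mul_div, div_le_iff₀ hc]
    nlinarith
  have hw' := mul_pos hlam (hw g)
  rw [norm_smul, Real.norm_of_nonneg (by positivity), one_div, inv_mul_le_iff₀ hn']
  rcases (norm_nonneg v).eq_or_lt with h0 | h0
  · rw [← h0]; positivity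
  · rw [sq] at hlim
    exact le_of_mul_le_mul_right hlim h0
end

section
/- Let E₁, …, E_G be finite-dimensional real inner product spaces, let X_g : E_g → ℝⁿ be linear maps, let y ∈ ℝⁿ, let λ > 0 and w₁, …, w_G > 0, and define the group-lasso objective F(θ) = (1/(2n))‖y − Σ_g X_g θ_g‖² + λ Σ_g w_g ‖θ_g‖ for θ = (θ₁, …, θ_G) in the product space Π_g E_g. If θ̂ is a global minimizer of F and for some group g the strict inequality ‖(1/n) X_g^*(y − Σ_{g'} X_{g'} θ̂_{g'})‖ < λ w_g holds, then θ̂_g = 0. -/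
open scoped BigOperators

/-- **Strict dual feasibility forces a zero block**: if at a global minimizer of the
group-lasso objective a group satisfies the strict inequality
`‖(1/n) X_g^*(y − X θ̂)‖ < λ w_g`, then `θ̂_g = 0`. -/
theorem group_lasso_strict_dual_feasibility_zero_block
    {n G : ℕ} (hn : 0 < n) (E : Fin G → Type*)
    [∀ g, NormedAddCommGroup (E g)] [∀ g, InnerProductSpace ℝ (E g)]
    [∀ g, FiniteDimensional ℝ (E g)]
    (X : ∀ g, E g →L[ℝ] EuclideanSpace ℝ (Fin n))
    (y : EuclideanSpace ℝ (Fin n))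
    (lam : ℝ) (hlam : 0 < lam) (w : Fin G → ℝ) (hw : ∀ g, 0 < w g)
    (F : (∀ g, E g) → ℝ)
    (hF : ∀ θ : ∀ g, E g, F θ =
      (1 / (2 * (n : ℝ))) * ‖y - ∑ g, X g (θ g)‖ ^ 2 + lam * ∑ g, w g * ‖θ g‖)
    (θhat : ∀ g, E g) (hmin : ∀ θ : ∀ g, E g, F θhat ≤ F θ)
    (g : Fin G)
    (hstrict : ‖(1 / (n : ℝ)) •
        (ContinuousLinearMap.adjoint (X g)) (y - ∑ g', X g' (θhat g'))‖ < lam * w g) :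
    θhat g = 0 := by
  by_contra hv
  have hn' : (0 : ℝ) < n := by exact_mod_cast hn
  have hvpos : 0 < ‖θhat g‖ := norm_pos_iff.mpr hv
  set r := y - ∑ g', X g' (θhat g') with hr
  set v := θhat g with hvdef
  -- the key inequality along the segment towards zero
  have key : ∀ t : ℝ, 0 < t → t ≤ 1 →
      lam * w g * ‖v‖ ≤ (1 / (n : ℝ)) * inner ℝ r (X g v)
        + t * ((1 / (2 * (n : ℝ))) * ‖X g v‖ ^ 2) := by
    intro t ht ht1
    have h := hmin (Function.update θhat g ((1 - t) • v))
    have hX : ∑ h, X h (Function.update θhat g ((1 - t) • v) h)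
        = ∑ h, X h (θhat h) - t • X g v := by
      have h1 : ∀ h, X h (Function.update θhat g ((1 - t) • v) h)
          = X h (θhat h) - if h = g then t • X g v else 0 := by
        intro h
        by_cases hh : h = g
        · subst hh
          simp [sub_smul, hvdef]
        · simp [hh]
      simp only [h1, Finset.sum_sub_distrib, Finset.sum_ite_eq', Finset.mem_univ, if_true]
    have hW : ∑ h, w h * ‖Function.update θhat g ((1 - t) • v) h‖
        = ∑ h, w h * ‖θhat h‖ - t * (w g * ‖v‖) := by
      have h1 : ∀ h, w h * ‖Function.update θhat g ((1 - t) • v) h‖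
          = w h * ‖θhat h‖ - if h = g then t * (w g * ‖v‖) else 0 := by
        intro h
        by_cases hh : h = g
        · subst hh
          simp only [Function.update_self, norm_smul, Real.norm_eq_abs,
            abs_of_nonneg (sub_nonneg.mpr ht1), if_true, ← hvdef]
          ring
        · simp [hh]
      simp only [h1, Finset.sum_sub_distrib, Finset.sum_ite_eq', Finset.mem_univ, if_true]
    have hres : y - (∑ h, X h (θhat h) - t • X g v) = r + t • X g v := by
      rw [hr]; abel
    rw [hF, hF, hX, hW, hres, ← hr, norm_add_sq_real, inner_smul_right, norm_smul,
      Real.norm_eq_abs, abs_of_pos ht] at h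
    have e : (1 / (n : ℝ)) = 2 * (1 / (2 * (n : ℝ))) := by field_simp
    rw [e]
    refine le_of_mul_le_mul_left ?_ ht
    linarith
  have ha : (1 / (n : ℝ)) * inner ℝ r (X g v) < lam * w g * ‖v‖ := by
    have e : (1 / (n : ℝ)) * inner ℝ r (X g v)
        = inner ℝ ((1 / (n : ℝ)) • (ContinuousLinearMap.adjoint (X g)) r) v := by
      rw [real_inner_smul_left, ContinuousLinearMap.adjoint_inner_left]
    rw [e]
    exact (real_inner_le_norm _ _).trans_lt (mul_lt_mul_of_pos_right hstrict hvpos)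
  set a := (1 / (n : ℝ)) * inner ℝ r (X g v)
  have hb : 0 ≤ (1 / (2 * (n : ℝ))) * ‖X g v‖ ^ 2 := by positivity
  set b := (1 / (2 * (n : ℝ))) * ‖X g v‖ ^ 2
  obtain ⟨d, hd⟩ : ∃ d, d = lam * w g * ‖v‖ - a := ⟨_, rfl⟩
  have hdpos : 0 < d := by linarith
  have hdb : 0 < d + b := by linarith
  have h := key (d / (d + b)) (by positivity) ((div_le_one hdb).mpr (by linarith))
  have h2 : d ≤ d / (d + b) * b := by linarith
  rw [div_mul_eq_mul_div, le_div_iff₀ hdb] at h2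
  nlinarith
end

section
/- Let E₁, …, E_G be finite-dimensional real inner product spaces, let X_g : E_g → ℝⁿ be linear maps, let λ > 0 and w₁, …, w_G > 0, and define the group-lasso objective F(θ) = (1/(2n))‖y − Σ_g X_g θ_g‖² + λ Σ_g w_g ‖θ_g‖ for θ = (θ₁, …, θ_G) in the product space Π_g E_g, equipped with the norm ‖θ‖² = Σ_g ‖θ_g‖². Suppose y = Σ_g X_g θ*_g + ε, that the restricted-eigenvalue condition (1/n)‖Σ_g X_g Δ_g‖² ≥ κ ‖Δ‖² holds for all Δ ∈ Π_g E_g with some κ > 0, and that the noise event ‖(1/n) X_g^* ε‖ ≤ λ w_g / 2 holds for every group g. If θ̂ is a global minimizer of F, then ‖θ̂ − θ*‖ ≤ (3λ/κ) (Σ_g w_g²)^{1/2}. -/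
open scoped BigOperators

/-- **Deterministic estimation-error bound for the group lasso**: under the
restricted-eigenvalue condition and the noise-control event
`‖(1/n) X_g^* ε‖ ≤ λ w_g / 2` for every group, any global minimizer `θ̂` of the
group-lasso objective satisfies `‖θ̂ − θ*‖ ≤ (3λ/κ)(Σ_g w_g²)^{1/2}` in the norm
`‖θ‖² = Σ_g ‖θ_g‖²`. -/
theorem group_lasso_estimation_error_bound
    {n G : ℕ} (hn : 0 < n) (E : Fin G → Type*)
    [∀ g, NormedAddCommGroup (E g)] [∀ g, InnerProductSpace ℝ (E g)]
    [∀ g, FiniteDimensional ℝ (E g)]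
    (X : ∀ g, E g →L[ℝ] EuclideanSpace ℝ (Fin n))
    (y : EuclideanSpace ℝ (Fin n))
    (lam : ℝ) (hlam : 0 < lam) (w : Fin G → ℝ) (hw : ∀ g, 0 < w g)
    (F : (∀ g, E g) → ℝ)
    (hF : ∀ θ : ∀ g, E g, F θ =
      (1 / (2 * (n : ℝ))) * ‖y - ∑ g, X g (θ g)‖ ^ 2 + lam * ∑ g, w g * ‖θ g‖)
    (θstar : ∀ g, E g) (ε : EuclideanSpace ℝ (Fin n))
    (hy : y = (∑ g, X g (θstar g)) + ε)
    (κ : ℝ) (hκ : 0 < κ)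
    (hRE : ∀ Δ : ∀ g, E g,
      κ * ∑ g, ‖Δ g‖ ^ 2 ≤ (1 / (n : ℝ)) * ‖∑ g, X g (Δ g)‖ ^ 2)
    (hnoise : ∀ g,
      ‖(1 / (n : ℝ)) • (ContinuousLinearMap.adjoint (X g)) ε‖ ≤ lam * w g / 2)
    (θhat : ∀ g, E g) (hmin : ∀ θ : ∀ g, E g, F θhat ≤ F θ) :
    Real.sqrt (∑ g, ‖θhat g - θstar g‖ ^ 2) ≤
      (3 * lam / κ) * Real.sqrt (∑ g, (w g) ^ 2) := by
  have hn' : (0 : ℝ) < n := by exact_mod_cast hn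
  have hm := hmin θstar
  rw [hF, hF] at hm
  have hv : y - ∑ g, X g (θhat g) = ε - ∑ g, X g (θhat g - θstar g) := by
    rw [hy]
    simp only [map_sub, Finset.sum_sub_distrib]
    abel
  have hs : y - ∑ g, X g (θstar g) = ε := by rw [hy]; abel
  rw [hv, hs, norm_sub_sq_real] at hm
  have hRE' := hRE (fun g => θhat g - θstar g)
  have hinner : (1 / (n : ℝ)) * inner ℝ ε (∑ g, X g (θhat g - θstar g)) ≤
      ∑ g, lam * w g / 2 * ‖θhat g - θstar g‖ := by
    rw [inner_sum, Finset.mul_sum]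
    refine Finset.sum_le_sum fun g _ => ?_
    rw [← ContinuousLinearMap.adjoint_inner_left, ← real_inner_smul_left]
    exact (real_inner_le_norm _ _).trans
      (mul_le_mul_of_nonneg_right (hnoise g) (norm_nonneg _))
  have htri : ∑ g, w g * ‖θstar g‖ ≤
      ∑ g, w g * ‖θhat g‖ + ∑ g, w g * ‖θhat g - θstar g‖ := by
    rw [← Finset.sum_add_distrib]
    refine Finset.sum_le_sum fun g _ => ?_
    rw [← mul_add]
    refine mul_le_mul_of_nonneg_left ?_ (hw g).le
    have := norm_sub_norm_le (θstar g) (θhat g)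
    rw [norm_sub_rev] at this
    linarith
  have hsum : ∑ g, lam * w g / 2 * ‖θhat g - θstar g‖ =
      lam / 2 * ∑ g, w g * ‖θhat g - θstar g‖ := by
    rw [Finset.mul_sum]
    exact Finset.sum_congr rfl fun g _ => by ring
  have hcs := Real.sum_mul_le_sqrt_mul_sqrt Finset.univ w (fun g => ‖θhat g - θstar g‖)
  have hS : Real.sqrt (∑ g, ‖θhat g - θstar g‖ ^ 2) ^ 2 = ∑ g, ‖θhat g - θstar g‖ ^ 2 :=
    Real.sq_sqrt (Finset.sum_nonneg fun g _ => sq_nonneg _)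
  rw [hsum] at hinner
  have htri' := mul_le_mul_of_nonneg_left htri hlam.le
  have hcs' := mul_le_mul_of_nonneg_left hcs hlam.le
  have hhalf : 1 / (2 * (n : ℝ)) = (1 / (n : ℝ)) / 2 := by field_simp
  rw [hhalf] at hm
  rw [← hS] at hRE'
  have h0 := Real.sqrt_nonneg (∑ g, ‖θhat g - θstar g‖ ^ 2)
  have hW := Real.sqrt_nonneg (∑ g, (w g) ^ 2)
  generalize Real.sqrt (∑ g, ‖θhat g - θstar g‖ ^ 2) = S at *
  generalize Real.sqrt (∑ g, (w g) ^ 2) = W at *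
  have key : κ * S ^ 2 ≤ 3 * (lam * (W * S)) := by linarith
  rw [div_mul_eq_mul_div, le_div_iff₀ hκ]
  rcases h0.eq_or_lt with h | h
  · rw [← h, zero_mul]; positivity
  · refine le_of_mul_le_mul_right ?_ h
    linarith
end
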